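/- In any execution of the coding scheme Π (Algorithms 1–2) on inputs (x,y) with an arbitrary erasure pattern, for any two rounds i ≤ j: T^A(i) = T^A(j) if and only if r_A(i) = r_A(j), and T^B(i) = T^B(j) if and only if r_B(i) = r_B(j). -/

import Mathlib

/-!
Model of the coding scheme Π (Algorithms 1–2) of "Interactive coding resilient to an
unknown number of erasures".  A noiseless alternating binary protocol `π` of length `N`
is given by next-bit functions `fA fB : List Bool → Bool` (`fA t = π(x∣t)` on
even-length transcripts `t`, `fB t = π(y∣t)` on odd-length transcripts `t`).
Rounds are 1-indexed; round `i` consists of two timesteps whose erasures are given by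
`(E i).1` (odd timestep, Alice → Bob) and `(E i).2` (even timestep, Bob → Alice).
-/

namespace Scheme1

/-- Parity of a round number, as a Boolean. -/
def par (r : ℕ) : Bool := decide (r % 2 = 1)

/-- The joint state of Alice and Bob at the beginning of a round:
Alice's partial transcript `TA` and round counter `rA`; Bob's partial transcript `TB`,
round counter `rB`, error flag `err` and stored message `m = (bit, parity)`. -/
structure St where
  TA : List Bool
  rA : ℕ
  TB : List Bool
  rB : ℕ
  err : Bool
  m : Bool × Bool
deriving DecidableEq

/-- The initial state. -/
def init : St := ⟨[], 0, [], 0, false, (false, false)⟩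

/-- The information bit `b_B(i)` Bob sends in a round, given the erasure `e1` of the
round's odd timestep and the state `s` at the beginning of the round. -/
def bobSentBit (fA fB : List Bool → Bool) (e1 : Bool) (s : St) : Bool :=
  let b := fA s.TA
  let bobErr : Bool := e1 || (par (s.rA + 1) == par s.rB)
  if bobErr then s.m.1 else fB (s.TB ++ [b])

/-- One round of the coding scheme Π of Algorithms 1–2; `e.1`/`e.2` tell whether the
odd/even timestep of the round is erased.  After Alice terminates (`rA = N/2`) the
recorded state no longer changes (Bob only resends his stored message upon erasures,
and terminates upon hearing silence). -/
def step (fA fB : List Bool → Bool) (N : ℕ) (e : Bool × Bool) (s : St) : St :=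
  if s.rA < N / 2 then
    -- odd timestep: Alice extends and sends (b, parity)
    let b := fA s.TA
    let rA1 := s.rA + 1
    -- Bob receives (⊥ if e.1)
    let bobErr : Bool := e.1 || (par rA1 == par s.rB)
    let TB' := if bobErr then s.TB else (s.TB ++ [b]) ++ [fB (s.TB ++ [b])]
    let rB' := if bobErr then s.rB else s.rB + 1
    let m' := if bobErr then s.m else (fB (s.TB ++ [b]), par (s.rB + 1))
    -- even timestep: Bob sends m'; Alice receives (⊥ if e.2)
    let aliceOk : Bool := !e.2 && (m'.2 == par rA1)
    let TA' := if aliceOk then (s.TA ++ [b]) ++ [m'.1] else s.TA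
    let rA' := if aliceOk then rA1 else s.rA
    ⟨TA', rA', TB', rB', bobErr, m'⟩
  else s

/-- `exec fA fB N E k` is the state after `k` rounds have been played. -/
def exec (fA fB : List Bool → Bool) (N : ℕ) (E : ℕ → Bool × Bool) : ℕ → St
  | 0 => init
  | k + 1 => step fA fB N (E (k + 1)) (exec fA fB N E k)

/-- `stAt fA fB N E i` is the state at the beginning of round `i` (rounds 1-indexed):
for a protocol variable `v`, `v(i) = (stAt … i).v`. -/
def stAt (fA fB : List Bool → Bool) (N : ℕ) (E : ℕ → Bool × Bool) (i : ℕ) : St :=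
  exec fA fB N E (i - 1)

/-- The noiseless transcript of `π` after `r` rounds; `transcript fA fB (N/2)` is `T^π`. -/
def transcript (fA fB : List Bool → Bool) : ℕ → List Bool
  | 0 => []
  | r + 1 =>
    let t := transcript fA fB r
    (t ++ [fA t]) ++ [fB (t ++ [fA t])]

/-- Alice's and Bob's transcripts both hold two bits per counted round. -/
def LengthInv (s : St) : Prop :=
  s.TA.length = 2 * s.rA ∧ s.TB.length = 2 * s.rB

theorem lengthInv_step (fA fB : List Bool → Bool) (N : ℕ) (e : Bool × Bool) {s : St}
    (h : LengthInv s) : LengthInv (step fA fB N e s) := by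
  obtain ⟨hA, hB⟩ := h
  unfold step
  split_ifs
  · constructor
    · dsimp only
      split_ifs <;> simp [hA] <;> ring
    · dsimp only
      split_ifs <;> simp [hB] <;> ring
  · exact ⟨hA, hB⟩

theorem lengthInv_exec (fA fB : List Bool → Bool) (N : ℕ) (E : ℕ → Bool × Bool) (k : ℕ) :
    LengthInv (exec fA fB N E k) := by
  induction k with
  | zero => exact ⟨rfl, rfl⟩
  | succ k ih => exact lengthInv_step fA fB N _ ih

theorem prefix_step (fA fB : List Bool → Bool) (N : ℕ) (e : Bool × Bool) (s : St) :
    s.TA <+: (step fA fB N e s).TA ∧ s.TB <+: (step fA fB N e s).TB := by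
  unfold step
  split_ifs
  · constructor
    · dsimp only
      split_ifs <;> simp
    · dsimp only
      split_ifs <;> simp
  · exact ⟨List.prefix_rfl, List.prefix_rfl⟩

theorem prefix_exec (fA fB : List Bool → Bool) (N : ℕ) (E : ℕ → Bool × Bool) {k l : ℕ}
    (hkl : k ≤ l) :
    (exec fA fB N E k).TA <+: (exec fA fB N E l).TA ∧
      (exec fA fB N E k).TB <+: (exec fA fB N E l).TB := by
  induction l, hkl using Nat.le_induction with
  | base => exact ⟨List.prefix_rfl, List.prefix_rfl⟩
  | succ l _ ih =>
    have h := prefix_step fA fB N (E (l + 1)) (exec fA fB N E l)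
    exact ⟨ih.1.trans h.1, ih.2.trans h.2⟩

theorem eq_iff_of_prefix_of_length {α : Type*} {s t : List α} {a b : ℕ} (h : s <+: t)
    (hs : s.length = 2 * a) (ht : t.length = 2 * b) : s = t ↔ a = b := by
  constructor
  · rintro rfl
    omega
  · rintro rfl
    exact h.eq_of_length (hs.trans ht.symm)

/-- Corollary 3 of the paper.  In any execution of Π, for any two
rounds `i ≤ j` (within the run, i.e. `1 ≤ i`, `j ≤ t_B`), `T^A(i) = T^A(j)` iff
`r_A(i) = r_A(j)`, and `T^B(i) = T^B(j)` iff `r_B(i) = r_B(j)`. -/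
theorem scheme1_transcript_iff_counter
    (fA fB : List Bool → Bool) (N : ℕ) (hN : 0 < N) (hNeven : Even N)
    (E : ℕ → Bool × Bool) (tA tB : ℕ)
    (htA1 : ∀ i, 1 ≤ i → i ≤ tA → (stAt fA fB N E i).rA < N / 2)
    (htA2 : (stAt fA fB N E (tA + 1)).rA = N / 2)
    (htB1 : tA < tB)
    (htB2 : ∀ i, tA < i → i < tB → (E i).1 = true)
    (htB3 : (E tB).1 = false)
    (i j : ℕ) (hi : 1 ≤ i) (hij : i ≤ j) (hj : j ≤ tB) :
    ((stAt fA fB N E i).TA = (stAt fA fB N E j).TA ↔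
      (stAt fA fB N E i).rA = (stAt fA fB N E j).rA) ∧
    ((stAt fA fB N E i).TB = (stAt fA fB N E j).TB ↔
      (stAt fA fB N E i).rB = (stAt fA fB N E j).rB) := by
  have hp := prefix_exec fA fB N E (Nat.sub_le_sub_right hij 1)
  have hI := lengthInv_exec fA fB N E (i - 1)
  have hJ := lengthInv_exec fA fB N E (j - 1)
  exact ⟨eq_iff_of_prefix_of_length hp.1 hI.1 hJ.1, eq_iff_of_prefix_of_length hp.2 hI.2 hJ.2⟩

end Scheme1
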